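/- Let Φ(x) = 2(1 − 1/x)^{x−1} Γ(1/2 + x/2) Γ(x) / (Γ(1 + x/2) Γ(−1/2 + x)) for real x > 1, let F(s) = Φ′(s + 2)/Φ(s + 2) denote the logarithmic derivative, and let κ = 1 + 1/√12. Then for every real s with −1 < s < 0, −F(s) > (1/24) [ 1/(κ + s)² − 1/(κ + s/2)² ]. -/

import Mathlib

noncomputable def Phi (x : ℝ) : ℝ :=
  2 * (1 - 1 / x) ^ (x - 1) * (Real.Gamma (1/2 + x/2) * Real.Gamma x) /
    (Real.Gamma (1 + x/2) * Real.Gamma (-1/2 + x))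

noncomputable def kappa : ℝ := 1 + 1 / Real.sqrt 12

/-- The logarithmic derivative of the real Gamma function. -/
noncomputable def realDigamma (x : ℝ) : ℝ := deriv (fun y => Real.log (Real.Gamma y)) x

theorem hasDerivAt_log_Gamma {x : ℝ} (hx : 0 < x) :
    HasDerivAt (fun y => Real.log (Real.Gamma y)) (realDigamma x) x := by
  have h : DifferentiableAt ℝ Real.Gamma x :=
    Real.differentiableAt_Gamma fun m => by
      have : (0 : ℝ) ≤ m := m.cast_nonneg
      linarith
  exact (h.log (Real.Gamma_pos_of_pos hx).ne').hasDerivAt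

theorem log_Gamma_add_one {x : ℝ} (hx : 0 < x) :
    Real.log (Real.Gamma (x + 1)) = Real.log x + Real.log (Real.Gamma x) := by
  rw [Real.Gamma_add_one hx.ne', Real.log_mul hx.ne' (Real.Gamma_pos_of_pos hx).ne']

theorem realDigamma_add_one {x : ℝ} (hx : 0 < x) :
    realDigamma (x + 1) = realDigamma x + 1 / x := by
  have h1 : HasDerivAt (fun y => Real.log (Real.Gamma (y + 1))) (realDigamma (x + 1)) x :=
    (hasDerivAt_log_Gamma (by linarith : 0 < x + 1)).comp_add_const x 1
  have h2 := (Real.hasDerivAt_log hx.ne').add (hasDerivAt_log_Gamma hx)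
  have h3 : (fun y => Real.log (Real.Gamma (y + 1))) =ᶠ[nhds x]
      (fun y => Real.log y + Real.log (Real.Gamma y)) := by
    filter_upwards [Ioi_mem_nhds hx] with y hy using log_Gamma_add_one hy
  rw [h1.unique (h2.congr_of_eventuallyEq h3)]
  ring

theorem realDigamma_le_log {x : ℝ} (hx : 0 < x) : realDigamma x ≤ Real.log x := by
  have h := Real.convexOn_log_Gamma.le_slope_of_hasDerivAt (x := x) (y := x + 1) hx
    (by simp only [Set.mem_Ioi]; linarith) (by linarith) (hasDerivAt_log_Gamma hx)
  rw [slope_def_field] at h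
  simp only [Function.comp_apply, log_Gamma_add_one hx] at h
  simpa using h

theorem log_sub_one_le_realDigamma {x : ℝ} (hx : 1 < x) :
    Real.log (x - 1) ≤ realDigamma x := by
  have h0 : 0 < x - 1 := by linarith
  have h := Real.convexOn_log_Gamma.slope_le_of_hasDerivAt (x := x - 1) (y := x) h0
    (by simp only [Set.mem_Ioi]; linarith) (by linarith)
    (hasDerivAt_log_Gamma (by linarith : 0 < x))
  have h2 := log_Gamma_add_one h0
  rw [sub_add_cancel] at h2
  rw [slope_def_field] at h
  simp only [Function.comp_apply, h2] at h
  simpa using h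

/-- The error of the approximation `log y + 1 / (24 (y + c) ^ 2)` to the digamma function at
`y + 1 / 2`. -/
noncomputable def digammaError (c y : ℝ) : ℝ :=
  realDigamma (y + 1 / 2) - Real.log y - 1 / 24 * (1 / (y + c) ^ 2)

/-- The difference `digammaError c y - digammaError c (y + 1)` in elementary terms. -/
noncomputable def digammaErrorStep (c y : ℝ) : ℝ :=
  Real.log (y + 1) - Real.log y - 1 / (y + 1 / 2)
    - 1 / 24 * (1 / (y + c) ^ 2 - 1 / (y + 1 + c) ^ 2)

theorem digammaError_eq_add_step (c : ℝ) {y : ℝ} (hy : 0 < y) :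
    digammaError c y = digammaErrorStep c y + digammaError c (y + 1) := by
  have h := realDigamma_add_one (by linarith : 0 < y + 1 / 2)
  rw [show y + 1 / 2 + 1 = y + 1 + 1 / 2 by ring] at h
  unfold digammaError digammaErrorStep
  rw [h]
  ring

theorem digammaError_eq_sum_add (c : ℝ) {y : ℝ} (hy : 0 < y) (n : ℕ) :
    digammaError c y =
      ∑ k ∈ Finset.range n, digammaErrorStep c (y + k) + digammaError c (y + n) := by
  induction n with
  | zero => simp
  | succ n ih =>
    rw [Finset.sum_range_succ, ih, digammaError_eq_add_step c (by positivity : 0 < y + n)]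
    push_cast
    rw [add_assoc y]
    ring

theorem tendsto_log_add_sub_log (a : ℝ) :
    Filter.Tendsto (fun y => Real.log (y + a) - Real.log y) Filter.atTop (nhds 0) := by
  have h1 : Filter.Tendsto (fun y : ℝ => Real.log (1 + a * y⁻¹)) Filter.atTop (nhds 0) := by
    have h : Filter.Tendsto (fun y : ℝ => 1 + a * y⁻¹) Filter.atTop (nhds (1 + a * 0)) :=
      (tendsto_inv_atTop_zero.const_mul a).const_add 1
    have h' := h.log (by norm_num)
    simpa using h'
  refine h1.congr' ?_
  filter_upwards [Filter.eventually_gt_atTop 0, Filter.eventually_gt_atTop (-a)] with y hy hya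
  rw [← Real.log_div (by linarith) hy.ne']
  congr 1
  field_simp

theorem tendsto_digammaError (c : ℝ) :
    Filter.Tendsto (digammaError c) Filter.atTop (nhds 0) := by
  have h1 : Filter.Tendsto (fun y => realDigamma (y + 1 / 2) - Real.log y)
      Filter.atTop (nhds 0) := by
    refine tendsto_of_tendsto_of_tendsto_of_le_of_le' (tendsto_log_add_sub_log (-(1 / 2)))
      (tendsto_log_add_sub_log (1 / 2)) ?_ ?_
    · filter_upwards [Filter.eventually_gt_atTop 1] with y hy
      have h := log_sub_one_le_realDigamma (by linarith : 1 < y + 1 / 2)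
      rw [show y + 1 / 2 - 1 = y + -(1 / 2) by ring] at h
      linarith
    · filter_upwards [Filter.eventually_gt_atTop 1] with y hy
      have h := realDigamma_le_log (by linarith : 0 < y + 1 / 2)
      linarith
  have h2 : Filter.Tendsto (fun y : ℝ => 1 / 24 * (1 / (y + c) ^ 2)) Filter.atTop
      (nhds (1 / 24 * 0)) := by
    refine Filter.Tendsto.const_mul _ (Filter.Tendsto.div_atTop tendsto_const_nhds ?_)
    exact (Filter.tendsto_pow_atTop (by norm_num)).comp
      (Filter.tendsto_atTop_add_const_right _ c Filter.tendsto_id)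
  have h := h1.sub h2
  rw [mul_zero, sub_zero] at h
  exact h

theorem hasDerivAt_digammaErrorStep {c y : ℝ} (hc : 0 < c) (hy : 0 < y) :
    HasDerivAt (digammaErrorStep c)
      (1 / 12 * (1 / (y + c) ^ 3 - 1 / (y + 1 + c) ^ 3)
        - 1 / (4 * (y * (y + 1)) * (y + 1 / 2) ^ 2)) y := by
  have hid := hasDerivAt_id' y
  have h1 := (hid.add_const 1).log (by positivity)
  have h2 := Real.hasDerivAt_log hy.ne'
  have h3 := (hid.add_const (1 / 2)).fun_inv (by positivity)
  have h4 := ((hid.add_const c).fun_pow 2).fun_inv (by positivity)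
  have h5 := (((hid.add_const 1).add_const c).fun_pow 2).fun_inv (by positivity)
  have h := ((h1.sub h2).sub h3).sub ((h4.sub h5).const_mul (1 / 24))
  unfold digammaErrorStep
  simp only [one_div] at h ⊢
  refine h.congr_deriv ?_
  have e1 : 1 / (y + 1) - y⁻¹ - -1 / (y + 2⁻¹) ^ 2
      = - (4 * (y * (y + 1)) * (y + 2⁻¹) ^ 2)⁻¹ := by
    field_simp
    ring
  have e2 : ∀ z : ℝ, 0 < z → -(2 * z) / (z ^ 2) ^ 2 = -2 * (z ^ 3)⁻¹ := by
    intro z hz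
    field_simp
  have f1 := e2 (y + c) (by positivity)
  have f2 := e2 (y + 1 + c) (by positivity)
  norm_num at e1 f1 f2 ⊢
  rw [f1, f2]
  linarith

theorem deriv_digammaErrorStep_neg {c y : ℝ} (hc : 1 / 4 < c) (hcsq : c ^ 2 = 1 / 12)
    (hy : 0 < y) : deriv (digammaErrorStep c) y < 0 := by
  have hc0 : 0 < c := by linarith
  rw [(hasDerivAt_digammaErrorStep hc0 hy).deriv, sub_neg]
  obtain ⟨e, he⟩ : ∃ e, (y + c) * (y + 1 + c) = y * (y + 1) + 1 / 3 + e :=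
    ⟨_, (add_sub_cancel _ _).symm⟩
  have he0 : 0 < e := by nlinarith [mul_pos hc0 hy]
  have hl : 1 / 12 * (1 / (y + c) ^ 3 - 1 / (y + 1 + c) ^ 3)
      = (3 * ((y + c) * (y + 1 + c)) + 1) / (12 * ((y + c) * (y + 1 + c)) ^ 3) := by
    field_simp
    ring
  rw [hl, he, show (y + 1 / 2) ^ 2 = y * (y + 1) + 1 / 4 by ring]
  have hY : 0 < y * (y + 1) := by positivity
  generalize y * (y + 1) = Y at hY ⊢
  rw [div_lt_div_iff₀ (by positivity) (by positivity), ← sub_pos]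
  have : 0 < 12 * (Y ^ 2 / 4 + Y / 2 + 1 / 9
      + e * (6 * Y ^ 2 + 21 / 4 * Y + 1) + e ^ 2 * (9 * Y + 3) + 3 * e ^ 3) := by positivity
  linarith

theorem strictAntiOn_digammaErrorStep {c : ℝ} (hc : 1 / 4 < c) (hcsq : c ^ 2 = 1 / 12) :
    StrictAntiOn (digammaErrorStep c) (Set.Ioi 0) := by
  refine strictAntiOn_of_deriv_neg (convex_Ioi 0) (fun y hy => ?_) (fun y hy => ?_)
  · exact (hasDerivAt_digammaErrorStep (by linarith) hy).continuousAt.continuousWithinAt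
  · rw [interior_Ioi] at hy
    exact deriv_digammaErrorStep_neg hc hcsq hy

theorem strictAntiOn_digammaError {c : ℝ} (hc : 1 / 4 < c) (hcsq : c ^ 2 = 1 / 12) :
    StrictAntiOn (digammaError c) (Set.Ioi 0) := by
  intro y hy z hz hyz
  simp only [Set.mem_Ioi] at hy hz
  have anti := strictAntiOn_digammaErrorStep hc hcsq
  have hle : ∀ y z : ℝ, 0 < y → y < z → digammaError c z ≤ digammaError c y := by
    intro y z hy hyz
    have hz := hy.trans hyz
    have hlim (w : ℝ) :
        Filter.Tendsto (fun n : ℕ => digammaError c (w + n)) Filter.atTop (nhds 0) :=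
      (tendsto_digammaError c).comp
        (Filter.tendsto_atTop_add_const_left _ w tendsto_natCast_atTop_atTop)
    have h : digammaError c z - digammaError c y ≤ 0 - 0 := by
      refine ge_of_tendsto' ((hlim z).sub (hlim y)) fun n => ?_
      rw [digammaError_eq_sum_add c hy n, digammaError_eq_sum_add c hz n]
      have : ∑ k ∈ Finset.range n, digammaErrorStep c (z + k)
          ≤ ∑ k ∈ Finset.range n, digammaErrorStep c (y + k) := by
        refine Finset.sum_le_sum fun k _ => (anti ?_ ?_ (by linarith)).le
        all_goals simp only [Set.mem_Ioi]; positivity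
      linarith
    linarith
  rw [digammaError_eq_add_step c hy, digammaError_eq_add_step c hz]
  exact add_lt_add_of_lt_of_le (anti hy hz hyz) (hle _ _ (by linarith) (by linarith))

theorem Phi_eq_exp {x : ℝ} (hx : 1 < x) :
    Phi x = Real.exp ((x - 1) * Real.log (1 - 1 / x) + (x + 1) * Real.log 2 - Real.log x
      + 2 * Real.log (Real.Gamma (x / 2 + 1 / 2)) - Real.log (Real.Gamma (x - 1 / 2))
      - Real.log (Real.sqrt Real.pi)) := by
  have hx0 : 0 < x := by linarith
  have hb : 0 < 1 - 1 / x := by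
    rw [sub_pos, div_lt_one hx0]
    exact hx
  have g1 := Real.Gamma_pos_of_pos (by linarith : 0 < x / 2)
  have g2 := Real.Gamma_pos_of_pos (by linarith : 0 < x / 2 + 1 / 2)
  have g3 := Real.Gamma_pos_of_pos (by linarith : 0 < x - 1 / 2)
  have g4 := Real.Gamma_pos_of_pos hx0
  have hpi : 0 < Real.sqrt Real.pi := Real.sqrt_pos.mpr Real.pi_pos
  have hd := congrArg Real.log (Real.Gamma_mul_Gamma_add_half (x / 2))
  rw [show 2 * (x / 2) = x by ring, Real.log_mul g1.ne' g2.ne',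
    Real.log_mul (by positivity) hpi.ne', Real.log_mul g4.ne' (by positivity),
    Real.log_rpow two_pos] at hd
  have hs := log_Gamma_add_one (by linarith : 0 < x / 2)
  rw [Real.log_div hx0.ne' two_ne_zero] at hs
  have hp := Real.rpow_pos_of_pos hb (x - 1)
  have g5 := Real.Gamma_pos_of_pos (by linarith : 0 < x / 2 + 1)
  unfold Phi
  rw [add_comm (1 / 2) (x / 2), add_comm 1 (x / 2), show -1 / 2 + x = x - 1 / 2 by ring,
    ← Real.exp_log (show 0 < 2 * (1 - 1 / x) ^ (x - 1)
      * (Real.Gamma (x / 2 + 1 / 2) * Real.Gamma x)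
      / (Real.Gamma (x / 2 + 1) * Real.Gamma (x - 1 / 2)) by positivity),
    Real.log_div (by positivity) (by positivity), Real.log_mul (by positivity) (by positivity),
    Real.log_mul (by positivity) (by positivity), Real.log_mul (by positivity) (by positivity),
    Real.log_mul (by positivity) (by positivity), Real.log_rpow hb, hs]
  congr 1
  linarith

theorem logDeriv_Phi {x : ℝ} (hx : 1 < x) :
    deriv Phi x / Phi x = (realDigamma (x / 2 + 1 / 2) - Real.log (x / 2))
      - (realDigamma (x - 1 + 1 / 2) - Real.log (x - 1)) := by
  have hx0 : 0 < x := by linarith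
  have hx1 : 0 < x - 1 := by linarith
  have hb : 0 < 1 - 1 / x := by
    rw [sub_pos, div_lt_one hx0]
    exact hx
  have hid := hasDerivAt_id' x
  have h1 : HasDerivAt (fun y : ℝ => 1 - 1 / y) (1 / x ^ 2) x := by
    have := (hid.fun_inv hx0.ne').const_sub 1
    simp only [one_div]
    exact this.congr_deriv (by ring)
  have h2 : HasDerivAt (fun y => Real.log (Real.Gamma (y / 2 + 1 / 2)))
      (realDigamma (x / 2 + 1 / 2) * (1 / 2)) x :=
    HasDerivAt.comp (h₂ := fun y => Real.log (Real.Gamma y)) x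
      (hasDerivAt_log_Gamma (by linarith : 0 < x / 2 + 1 / 2))
      ((hid.div_const 2).add_const (1 / 2))
  have h3 : HasDerivAt (fun y => Real.log (Real.Gamma (y - 1 / 2)))
      (realDigamma (x - 1 / 2)) x :=
    (hasDerivAt_log_Gamma (by linarith : 0 < x - 1 / 2)).comp_sub_const x (1 / 2)
  have h := ((((((hid.sub_const 1).fun_mul (h1.log hb.ne')).fun_add
    ((hid.add_const 1).mul_const (Real.log 2))).fun_sub (Real.hasDerivAt_log hx0.ne')).fun_add
    (h2.const_mul 2)).fun_sub h3).sub_const (Real.log (Real.sqrt Real.pi))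
  have heq : Phi =ᶠ[nhds x] fun y => Real.exp ((y - 1) * Real.log (1 - 1 / y)
      + (y + 1) * Real.log 2 - Real.log y + 2 * Real.log (Real.Gamma (y / 2 + 1 / 2))
      - Real.log (Real.Gamma (y - 1 / 2)) - Real.log (Real.sqrt Real.pi)) := by
    filter_upwards [Ioi_mem_nhds hx] with y hy using Phi_eq_exp hy
  rw [(h.exp.congr_of_eventuallyEq heq).deriv, Phi_eq_exp hx,
    mul_div_cancel_left₀ _ (Real.exp_pos _).ne', show x - 1 + 1 / 2 = x - 1 / 2 by ring,
    show 1 - 1 / x = (x - 1) / x by field_simp, Real.log_div hx1.ne' hx0.ne',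
    Real.log_div hx0.ne' two_ne_zero]
  have : (x - 1) * (1 / x ^ 2 / ((x - 1) / x)) = x⁻¹ := by field_simp
  rw [this]
  ring

theorem stmt_13 (s : ℝ) (hs₁ : -1 < s) (hs₂ : s < 0) :
    -(deriv Phi (s + 2) / Phi (s + 2)) >
      (1/24) * (1 / (kappa + s) ^ 2 - 1 / (kappa + s/2) ^ 2) := by
  have hc : 1 / 4 < 1 / Real.sqrt 12 :=
    one_div_lt_one_div_of_lt (Real.sqrt_pos.mpr (by norm_num))
      ((Real.sqrt_lt' (by norm_num)).mpr (by norm_num))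
  have hcsq : (1 / Real.sqrt 12) ^ 2 = 1 / 12 := by
    rw [div_pow, Real.sq_sqrt (by norm_num), one_pow]
  have h := strictAntiOn_digammaError hc hcsq (a := 1 + s) (b := 1 + s / 2)
    (by simp only [Set.mem_Ioi]; linarith) (by simp only [Set.mem_Ioi]; linarith) (by linarith)
  rw [logDeriv_Phi (by linarith), show (s + 2) / 2 = 1 + s / 2 by ring,
    show s + 2 - 1 = 1 + s by ring]
  unfold kappa
  unfold digammaError at h
  rw [add_right_comm 1 (1 / Real.sqrt 12) s, add_right_comm 1 (1 / Real.sqrt 12) (s / 2)]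
  linarith
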